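/- For every n ≥ 2, the sequence x1² − x2², x2² − x3², …, x_{n−1}² − x_n² is a regular sequence on the polynomial ring ℤ[x1, …, xn] (i.e., on MvPolynomial (Fin n) ℤ, the list [X 0 ^ 2 − X 1 ^ 2, X 1 ^ 2 − X 2 ^ 2, …, X (n−2) ^ 2 − X (n−1) ^ 2] is a regular sequence). -/

import Mathlib

open MvPolynomial

/-- If an ideal is generated by polynomials not involving the variable `j`, then a polynomial
`a - X j ^ m` with `a` not involving `j` is a nonzerodivisor modulo that ideal. -/
theorem MvPolynomial.mem_span_of_sub_X_pow_mul_mem {σ R : Type*} [CommRing R] {j : σ}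
    {S : Set (MvPolynomial σ R)} (hS : ∀ p ∈ S, j ∉ p.vars) {a : MvPolynomial σ R}
    (ha : j ∉ a.vars) {m : ℕ} (hm : m ≠ 0) {f : MvPolynomial σ R}
    (hf : (a - X j ^ m) * f ∈ Ideal.span S) : f ∈ Ideal.span S := by
  classical
  let mk := Ideal.Quotient.mk (Ideal.span S)
  let φ : MvPolynomial σ R →+* Polynomial (MvPolynomial σ R ⧸ Ideal.span S) :=
    eval₂Hom (Polynomial.C.comp (mk.comp C))
      fun k => if k = j then Polynomial.X else Polynomial.C (mk (X k))
  have hφ : ∀ p : MvPolynomial σ R, j ∉ p.vars → φ p = Polynomial.C (mk p) := by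
    intro p hp
    have h : (Polynomial.C.comp mk) p = eval₂Hom (Polynomial.C.comp (mk.comp C))
        (fun k => Polynomial.C (mk (X k))) p := by
      congr 1
      ext <;> simp
    refine Eq.trans (eval₂Hom_congr' rfl ?_ rfl) h.symm
    intro k hk _
    have hkj : k ≠ j := fun e => hp (e ▸ hk)
    simp [hkj]
  have hspan : ∀ p ∈ Ideal.span S, φ p = 0 := by
    suffices Ideal.span S ≤ RingHom.ker φ from fun p hp => this hp
    refine Ideal.span_le.mpr fun p hp => ?_
    have : mk p = 0 := Ideal.Quotient.eq_zero_iff_mem.mpr (Ideal.subset_span hp)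
    simp [RingHom.mem_ker, hφ p (hS p hp), this]
  have heval : (Polynomial.evalRingHom (mk (X j))).comp φ = mk := by
    ext k
    · simp [φ]
    · by_cases hk : k = j <;> simp [φ, hk]
  have hφX : φ (X j) = Polynomial.X := by simp [φ]
  have h0 := hspan _ hf
  rw [map_mul, map_sub, map_pow, hφ a ha, hφX, ← neg_sub, neg_mul, neg_eq_zero,
    (Polynomial.monic_X_pow_sub_C (mk a) hm).mul_right_eq_zero_iff] at h0
  apply Ideal.Quotient.eq_zero_iff_mem.mp
  change mk f = 0
  rw [← heval, RingHom.comp_apply, h0, map_zero]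

/-- For every `n ≥ 2` (written `n + 2` below), the sequence
`x1² − x2², x2² − x3², …, x_{n−1}² − x_n²` is a regular sequence on the polynomial
ring `ℤ[x1, …, xn] = MvPolynomial (Fin n) ℤ`. -/
theorem stmt_11 (n : ℕ) :
    RingTheory.Sequence.IsRegular (MvPolynomial (Fin (n + 2)) ℤ)
      (List.ofFn fun k : Fin (n + 1) =>
        (X k.castSucc : MvPolynomial (Fin (n + 2)) ℤ) ^ 2 - X k.succ ^ 2) := by
  refine ⟨⟨fun i hi => ?_⟩, fun h => ?_⟩
  · have hi' : i < n + 1 := by simpa using hi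
    rw [isSMulRegular_iff_right_eq_zero_of_smul]
    intro x hx
    obtain ⟨f, rfl⟩ := Submodule.mkQ_surjective _ x
    rw [Submodule.mkQ_apply, ← Submodule.Quotient.mk_smul, Submodule.Quotient.mk_eq_zero,
      smul_eq_mul, Ideal.mul_top, List.getElem_ofFn, smul_eq_mul] at hx
    rw [Submodule.mkQ_apply, Submodule.Quotient.mk_eq_zero, smul_eq_mul, Ideal.mul_top]
    refine mem_span_of_sub_X_pow_mul_mem (j := Fin.succ ⟨i, hi'⟩) ?_ ?_ two_ne_zero hx
    · intro p hp hj
      obtain ⟨k, hk, rfl⟩ := List.mem_take_iff_getElem.mp hp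
      rw [List.getElem_ofFn] at hj
      have hki : k < i := by omega
      rcases Finset.mem_union.mp (vars_sub_subset _ hj) with hj | hj <;>
      · have := vars_pow _ _ hj
        simp only [vars_X, Finset.mem_singleton, Fin.ext_iff, Fin.val_succ,
          Fin.val_castSucc] at this
        omega
    · intro hj
      have := vars_pow _ _ hj
      simp [Fin.ext_iff] at this
  · rw [smul_eq_mul, Ideal.mul_top] at h
    have hle : Ideal.ofList (List.ofFn fun k : Fin (n + 1) =>
        (X k.castSucc : MvPolynomial (Fin (n + 2)) ℤ) ^ 2 - X k.succ ^ 2) ≤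
        RingHom.ker (constantCoeff (R := ℤ) (σ := Fin (n + 2))) := by
      refine Ideal.span_le.mpr fun p hp => ?_
      obtain ⟨k, rfl⟩ := List.mem_ofFn.mp hp
      simp [RingHom.mem_ker]
    exact RingHom.ker_ne_top _ (top_le_iff.mp (h.trans_le hle))
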